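/- (Characterization of the saddle point of the minimax game.) Let (X, μ) be a measure space and let p : X → ℝ≥0 be a measurable probability density with respect to μ. Over pairs (q, D) where q : X → ℝ≥0 is a measurable probability density with respect to μ and D : X → [0,1] is measurable, with V(q, D) = ∫ p·log D dμ + ∫ q·log(1−D) dμ, the following hold: (i) min over q of max over D of V(q, D) equals −log 4; (ii) the minimum is attained exactly when q = p μ-almost everywhere; and (iii) when q = p, the optimal discriminator satisfies D*(x) = 1/2 for μ-almost every x in {p > 0}, and V(p, D*) = −log 4. -/

import Mathlib

open MeasureTheory
open scoped NNReal ENNReal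

/-- Truncation of an extended real to `ℝ≥0∞` (negatives and `⊥` map to `0`). -/
noncomputable def erealToENNReal (x : EReal) : ℝ≥0∞ :=
  if x = ⊤ then ⊤ else ENNReal.ofReal x.toReal

/-- Integral of an extended-real-valued function, defined via the positive and
negative parts, with values in the extended reals. -/
noncomputable def eIntegral {X : Type*} [MeasurableSpace X] (μ : Measure X)
    (f : X → EReal) : EReal :=
  ((∫⁻ x, erealToENNReal (f x) ∂μ : ℝ≥0∞) : EReal)
    - ((∫⁻ x, erealToENNReal (-(f x)) ∂μ : ℝ≥0∞) : EReal)

/-- The GAN value function `V(D) = ∫ p·log D dμ + ∫ q·log (1 - D) dμ`, with the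
conventions `log 0 = -∞` and `0·(-∞) = 0` (via `ENNReal.log` and `EReal` arithmetic). -/
noncomputable def V {X : Type*} [MeasurableSpace X] (μ : Measure X)
    (p q : X → ℝ≥0) (D : X → ℝ) : EReal :=
  eIntegral μ (fun x => ((p x : ℝ≥0∞) : EReal) * ENNReal.log (ENNReal.ofReal (D x)))
    + eIntegral μ (fun x => ((q x : ℝ≥0∞) : EReal) * ENNReal.log (ENNReal.ofReal (1 - D x)))

/-- The optimal discriminator `D*(x) = p(x)/(p(x)+q(x))` on `{p+q > 0}`, set to `1/2`
elsewhere. -/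
noncomputable def Dstar {X : Type*} (p q : X → ℝ≥0) (x : X) : ℝ :=
  if p x + q x = 0 then 1 / 2 else (p x : ℝ) / ((p x : ℝ) + (q x : ℝ))

/-- The GAN criterion `C(p,q) = ∫ p·log (p/(p+q)) dμ + ∫ q·log (q/(p+q)) dμ`. -/
noncomputable def Cval {X : Type*} [MeasurableSpace X] (μ : Measure X)
    (p q : X → ℝ≥0) : EReal :=
  eIntegral μ (fun x =>
      ((p x : ℝ≥0∞) : EReal) * ENNReal.log ((p x : ℝ≥0∞) / ((p x : ℝ≥0∞) + (q x : ℝ≥0∞))))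
    + eIntegral μ (fun x =>
      ((q x : ℝ≥0∞) : EReal) * ENNReal.log ((q x : ℝ≥0∞) / ((p x : ℝ≥0∞) + (q x : ℝ≥0∞))))

/-- The Kullback--Leibler divergence `KL(f ‖ g) = ∫ f·log (f/g) dμ` between densities,
with the conventions `0·log (0/g) = 0` and `f·log (f/0) = +∞` for `f > 0`. -/
noncomputable def klDiv {X : Type*} [MeasurableSpace X] (μ : Measure X)
    (f g : X → ℝ≥0) : EReal :=
  eIntegral μ (fun x => ((f x : ℝ≥0∞) : EReal) * ENNReal.log ((f x : ℝ≥0∞) / (g x : ℝ≥0∞)))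


/-- The set of measurable discriminators `D : X → [0,1]`. -/
def Disc (X : Type*) [MeasurableSpace X] : Type _ :=
  {D : X → ℝ // Measurable D ∧ ∀ x, D x ∈ Set.Icc (0 : ℝ) 1}

/-- The set of measurable probability densities with respect to `μ`. -/
def Dens (X : Type*) [MeasurableSpace X] (μ : Measure X) : Type _ :=
  {q : X → ℝ≥0 // Measurable q ∧ ∫⁻ x, (q x : ℝ≥0∞) ∂μ = 1}

/-- The cost `-log t` with values in `ℝ≥0∞`, equal to `⊤` for `t ≤ 0`. -/
noncomputable def negLog (t : ℝ) : ℝ≥0∞ :=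
  if t ≤ 0 then ⊤ else ENNReal.ofReal (-Real.log t)

lemma negLog_of_pos {t : ℝ} (ht : 0 < t) : negLog t = ENNReal.ofReal (-Real.log t) :=
  if_neg ht.not_ge

lemma measurable_negLog : Measurable negLog :=
  Measurable.ite measurableSet_Iic measurable_const (by fun_prop)

lemma erealToENNReal_coe (r : ℝ) : erealToENNReal (r : EReal) = ENNReal.ofReal r := by
  simp [erealToENNReal]

lemma mul_log_ofReal_of_pos (a : ℝ≥0) {t : ℝ} (ht : 0 < t) :
    ((a : ℝ≥0∞) : EReal) * ENNReal.log (ENNReal.ofReal t) = ((a * Real.log t : ℝ) : EReal) := by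
  rw [ENNReal.log_ofReal_of_pos ht]
  rfl

lemma erealToENNReal_mul_log (a : ℝ≥0) {t : ℝ} (h0 : 0 ≤ t) (h1 : t ≤ 1) :
    erealToENNReal (((a : ℝ≥0∞) : EReal) * ENNReal.log (ENNReal.ofReal t)) = 0 := by
  rcases h0.eq_or_lt with rfl | ht
  · rcases eq_or_ne a 0 with rfl | ha
    · simp [erealToENNReal]
    · have : (0 : EReal) < ((a : ℝ≥0∞) : EReal) := by
        simpa [pos_iff_ne_zero] using ha
      simp [erealToENNReal, EReal.mul_bot_of_pos this]
  · rw [mul_log_ofReal_of_pos a ht, erealToENNReal_coe]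
    exact ENNReal.ofReal_of_nonpos
      (mul_nonpos_of_nonneg_of_nonpos a.2 (Real.log_nonpos h0 h1))

lemma erealToENNReal_neg_mul_log (a : ℝ≥0) {t : ℝ} (h0 : 0 ≤ t) :
    erealToENNReal (-(((a : ℝ≥0∞) : EReal) * ENNReal.log (ENNReal.ofReal t)))
      = a * negLog t := by
  rcases h0.eq_or_lt with rfl | ht
  · rcases eq_or_ne a 0 with rfl | ha
    · simp [erealToENNReal]
    · have : (0 : EReal) < ((a : ℝ≥0∞) : EReal) := by
        simpa [pos_iff_ne_zero] using ha
      simp [erealToENNReal, EReal.mul_bot_of_pos this, negLog, ha]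
  · rw [mul_log_ofReal_of_pos a ht, ← EReal.coe_neg, erealToENNReal_coe, negLog_of_pos ht,
      ← mul_neg, ENNReal.ofReal_mul a.coe_nonneg]
    simp

section

variable {X : Type*} [MeasurableSpace X]

lemma eIntegral_mul_log (μ : Measure X) (p : X → ℝ≥0) {D : X → ℝ}
    (hD : ∀ x, D x ∈ Set.Icc (0 : ℝ) 1) :
    eIntegral μ (fun x => ((p x : ℝ≥0∞) : EReal) * ENNReal.log (ENNReal.ofReal (D x)))
      = -((∫⁻ x, p x * negLog (D x) ∂μ : ℝ≥0∞) : EReal) := by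
  simp only [eIntegral, erealToENNReal_neg_mul_log _ (hD _).1,
    erealToENNReal_mul_log _ (hD _).1 (hD _).2]
  simp

/-- The discriminator loss `-V(q, D)` as an `ℝ≥0∞`-valued quantity. -/
noncomputable def discLoss (μ : Measure X) (p q : X → ℝ≥0) (D : X → ℝ) : ℝ≥0∞ :=
  ∫⁻ x, p x * negLog (D x) ∂μ + ∫⁻ x, q x * negLog (1 - D x) ∂μ

lemma V_eq_neg_discLoss (μ : Measure X) (p q : X → ℝ≥0) {D : X → ℝ}
    (hD : ∀ x, D x ∈ Set.Icc (0 : ℝ) 1) :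
    V μ p q D = -(discLoss μ p q D : EReal) := by
  have hD' : ∀ x, 1 - D x ∈ Set.Icc (0 : ℝ) 1 := fun x =>
    ⟨by linarith [(hD x).2], by linarith [(hD x).1]⟩
  rw [V, eIntegral_mul_log μ p hD, eIntegral_mul_log μ q hD', discLoss, EReal.coe_ennreal_add,
    EReal.neg_add (by simp) (by simp), sub_eq_add_neg]

lemma V_le_iff (μ : Measure X) (p q : X → ℝ≥0) {D : X → ℝ}
    (hD : ∀ x, D x ∈ Set.Icc (0 : ℝ) 1) {r : ℝ} (hr : 0 ≤ r) :
    V μ p q D ≤ ((-r : ℝ) : EReal) ↔ ENNReal.ofReal r ≤ discLoss μ p q D := by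
  rw [V_eq_neg_discLoss μ p q hD, EReal.coe_neg, EReal.neg_le_neg_iff,
    ← EReal.coe_ennreal_le_coe_ennreal_iff, EReal.coe_ennreal_ofReal, max_eq_left hr]

lemma V_eq_iff (μ : Measure X) (p q : X → ℝ≥0) {D : X → ℝ}
    (hD : ∀ x, D x ∈ Set.Icc (0 : ℝ) 1) {r : ℝ} (hr : 0 ≤ r) :
    V μ p q D = ((-r : ℝ) : EReal) ↔ discLoss μ p q D = ENNReal.ofReal r := by
  rw [V_eq_neg_discLoss μ p q hD, EReal.coe_neg, neg_inj,
    ← EReal.coe_ennreal_eq_coe_ennreal_iff, EReal.coe_ennreal_ofReal, max_eq_left hr]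

lemma log_four_eq : Real.log 4 = Real.log 2 + Real.log 2 := by
  rw [← Real.log_mul (by norm_num) (by norm_num)]
  norm_num

lemma log_four_nonneg : 0 ≤ Real.log 4 := Real.log_nonneg (by norm_num)

lemma negLog_half : negLog (1 / 2) = ENNReal.ofReal (Real.log 2) := by
  rw [negLog_of_pos (by norm_num), one_div, Real.log_inv, neg_neg]

lemma discLoss_half (μ : Measure X) {p q : X → ℝ≥0} (hp1 : ∫⁻ x, (p x : ℝ≥0∞) ∂μ = 1)
    (hq1 : ∫⁻ x, (q x : ℝ≥0∞) ∂μ = 1) :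
    discLoss μ p q (fun _ => 1 / 2) = ENNReal.ofReal (Real.log 4) := by
  have h2 : (0 : ℝ) ≤ Real.log 2 := Real.log_nonneg (by norm_num)
  have h : (1 : ℝ) - 1 / 2 = 1 / 2 := by norm_num
  simp only [discLoss, h, negLog_half]
  rw [lintegral_mul_const' _ _ ENNReal.ofReal_ne_top, lintegral_mul_const' _ _ ENNReal.ofReal_ne_top,
    hp1, hq1, one_mul, log_four_eq, ENNReal.ofReal_add h2 h2]

lemma log_four_le_neg_log_add {t : ℝ} (h0 : 0 < t) (h1 : t < 1) :
    Real.log 4 ≤ -Real.log t + -Real.log (1 - t) := by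
  have h : 0 < t * (1 - t) := mul_pos h0 (by linarith)
  have := Real.log_le_log h (show t * (1 - t) ≤ 4⁻¹ by nlinarith [sq_nonneg (2 * t - 1)])
  rw [Real.log_inv, Real.log_mul h0.ne' (by linarith)] at this
  linarith

lemma ofReal_log_four_le_negLog_add (t : ℝ) :
    ENNReal.ofReal (Real.log 4) ≤ negLog t + negLog (1 - t) := by
  by_cases h0 : t ≤ 0
  · simp [negLog, h0]
  by_cases h1 : 1 - t ≤ 0
  · simp [negLog, h1]
  push Not at h0 h1
  rw [negLog_of_pos h0, negLog_of_pos h1]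
  exact (ENNReal.ofReal_le_ofReal (log_four_le_neg_log_add h0 (by linarith))).trans
    ENNReal.ofReal_add_le

lemma eq_half_of_negLog_add_eq {t : ℝ}
    (h : negLog t + negLog (1 - t) = ENNReal.ofReal (Real.log 4)) : t = 1 / 2 := by
  by_cases h0 : t ≤ 0
  · simp [negLog, h0] at h
  by_cases h1 : 1 - t ≤ 0
  · simp [negLog, h1] at h
  push Not at h0 h1
  have e0 : 0 ≤ -Real.log t := neg_nonneg.2 (Real.log_nonpos h0.le (by linarith))
  have e1 : 0 ≤ -Real.log (1 - t) := neg_nonneg.2 (Real.log_nonpos h1.le (by linarith))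
  rw [negLog_of_pos h0, negLog_of_pos h1, ← ENNReal.ofReal_add e0 e1,
    ENNReal.ofReal_eq_ofReal_iff (add_nonneg e0 e1) log_four_nonneg] at h
  have h2 : Real.log (t * (1 - t)) = Real.log 4⁻¹ := by
    rw [Real.log_mul h0.ne' h1.ne', Real.log_inv]
    linarith
  have h3 := Real.log_injOn_pos (Set.mem_Ioi.2 (mul_pos h0 h1))
    (Set.mem_Ioi.2 (by norm_num : (0 : ℝ) < 4⁻¹)) h2
  have h4 : (2 * t - 1) ^ 2 = 0 := by linear_combination -4 * h3
  have h5 := pow_eq_zero_iff (two_ne_zero) |>.1 h4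
  linarith

lemma discLoss_self (μ : Measure X) {p : X → ℝ≥0} (hp : Measurable p) {D : X → ℝ}
    (hD : Measurable D) :
    discLoss μ p p D = ∫⁻ x, p x * (negLog (D x) + negLog (1 - D x)) ∂μ := by
  simp only [mul_add]
  rw [discLoss, lintegral_add_left]
  exact hp.coe_nnreal_ennreal.mul (measurable_negLog.comp hD)

lemma lintegral_mul_log_four (μ : Measure X) {p : X → ℝ≥0}
    (hp1 : ∫⁻ x, (p x : ℝ≥0∞) ∂μ = 1) :
    ∫⁻ x, p x * ENNReal.ofReal (Real.log 4) ∂μ = ENNReal.ofReal (Real.log 4) := by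
  rw [lintegral_mul_const' _ _ ENNReal.ofReal_ne_top, hp1, one_mul]

lemma log_four_le_discLoss_self (μ : Measure X) {p : X → ℝ≥0} (hp : Measurable p)
    (hp1 : ∫⁻ x, (p x : ℝ≥0∞) ∂μ = 1) {D : X → ℝ} (hD : Measurable D) :
    ENNReal.ofReal (Real.log 4) ≤ discLoss μ p p D := by
  rw [discLoss_self μ hp hD, ← lintegral_mul_log_four μ hp1]
  exact lintegral_mono fun x => mul_le_mul_right (ofReal_log_four_le_negLog_add _) _

lemma ae_eq_half_of_discLoss_self_eq (μ : Measure X) {p : X → ℝ≥0} (hp : Measurable p)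
    (hp1 : ∫⁻ x, (p x : ℝ≥0∞) ∂μ = 1) {D : X → ℝ} (hD : Measurable D)
    (h : discLoss μ p p D = ENNReal.ofReal (Real.log 4)) :
    ∀ᵐ x ∂μ, p x ≠ 0 → D x = 1 / 2 := by
  have hc := lintegral_mul_log_four μ hp1
  rw [discLoss_self μ hp hD] at h
  have hm : Measurable fun x => (p x : ℝ≥0∞) * (negLog (D x) + negLog (1 - D x)) :=
    hp.coe_nnreal_ennreal.mul ((measurable_negLog.comp hD).add
      (measurable_negLog.comp (measurable_const.sub hD)))
  have hae := ae_eq_of_ae_le_of_lintegral_le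
    (Filter.Eventually.of_forall fun x =>
      mul_le_mul_right (ofReal_log_four_le_negLog_add (D x)) (p x : ℝ≥0∞))
    (hc.trans_ne ENNReal.ofReal_ne_top) hm.aemeasurable (h.trans hc.symm).le
  filter_upwards [hae] with x hx hpx
  exact eq_half_of_negLog_add_eq
    (((ENNReal.mul_right_inj (by simpa using hpx) ENNReal.coe_ne_top).1 hx).symm)

lemma discLoss_congr_right {μ : Measure X} (p : X → ℝ≥0) {q q' : X → ℝ≥0} (h : q =ᵐ[μ] q')
    (D : X → ℝ) : discLoss μ p q D = discLoss μ p q' D := by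
  unfold discLoss
  congr 1
  exact lintegral_congr_ae (h.mono fun x hx => by simp only [hx])

/-- Two densities of equal finite mass agree a.e. if `p` has no more mass than `q` where
`q < p`. -/
lemma ae_eq_of_setLIntegral_lt_le {μ : Measure X} {p q : X → ℝ≥0} (hp : Measurable p)
    (hq : Measurable q) (hp1 : ∫⁻ x, (p x : ℝ≥0∞) ∂μ ≠ ⊤)
    (hpq : ∫⁻ x, (q x : ℝ≥0∞) ∂μ = ∫⁻ x, (p x : ℝ≥0∞) ∂μ)
    (h : ∫⁻ x in {x | q x < p x}, (p x : ℝ≥0∞) ∂μ ≤ ∫⁻ x in {x | q x < p x}, (q x : ℝ≥0∞) ∂μ) :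
    q =ᵐ[μ] p := by
  have hA : MeasurableSet {x | q x < p x} := measurableSet_lt hq hp
  have h1 : ∀ᵐ x ∂μ.restrict {x | q x < p x}, (q x : ℝ≥0∞) = p x := by
    refine ae_eq_of_ae_le_of_lintegral_le ?_ ?_ hp.coe_nnreal_ennreal.aemeasurable h
    · filter_upwards [ae_restrict_mem hA] with x hx
      exact_mod_cast le_of_lt hx
    · exact ne_top_of_le_ne_top (hpq.trans_ne hp1) (setLIntegral_le_lintegral _ _)
  have h2 : ∀ᵐ x ∂μ, (p x : ℝ≥0∞) ≤ q x := by
    rw [ae_restrict_iff' hA] at h1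
    filter_upwards [h1] with x hx
    by_contra hlt
    have hlt' : q x < p x := by exact_mod_cast not_le.1 hlt
    exact hlt (hx hlt').ge
  have h3 := ae_eq_of_ae_le_of_lintegral_le h2 hp1 hq.coe_nnreal_ennreal.aemeasurable hpq.le
  filter_upwards [h3] with x hx
  exact_mod_cast hx.symm

lemma perturbation_gain_pos {P Q : ℝ} (hQ : 0 ≤ Q) (hP : P ≤ 1) (h : Q < P) :
    0 < P * Real.log (1 + (P - Q) / 4) + Q * Real.log (1 - (P - Q) / 4) := by
  set t := (P - Q) / 4 with ht
  have ht0 : 0 < t := by linarith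
  have ht1 : t < 1 := by linarith
  have a := Real.one_sub_inv_le_log_of_pos (show 0 < 1 + t by linarith)
  have b := Real.one_sub_inv_le_log_of_pos (show 0 < 1 - t by linarith)
  have key : 0 < P * (1 - (1 + t)⁻¹) + Q * (1 - (1 - t)⁻¹) := by
    have e : P * (1 - (1 + t)⁻¹) + Q * (1 - (1 - t)⁻¹)
        = t * (P * (1 - t) - Q * (1 + t)) / ((1 + t) * (1 - t)) := by
      have : 1 + t ≠ 0 := by linarith
      have : 1 - t ≠ 0 := by linarith
      field_simp
      ring
    rw [e]
    refine div_pos (mul_pos ht0 ?_) (mul_pos (by linarith) (by linarith))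
    nlinarith
  nlinarith [mul_le_mul_of_nonneg_left a (hQ.trans h.le), mul_le_mul_of_nonneg_left b hQ]

lemma lintegral_mul_ite {μ : Measure X} (p : X → ℝ≥0) {A : Set X} [DecidablePred (· ∈ A)]
    (hA : MeasurableSet A) (hp1 : ∫⁻ x, (p x : ℝ≥0∞) ∂μ = 1) {a c : ℝ} (ha : 0 ≤ a)
    (hc : 0 ≤ c) :
    ∫⁻ x, p x * (if x ∈ A then ENNReal.ofReal a else ENNReal.ofReal c) ∂μ
      = ENNReal.ofReal ((∫⁻ x in A, (p x : ℝ≥0∞) ∂μ).toReal * a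
          + (1 - (∫⁻ x in A, (p x : ℝ≥0∞) ∂μ).toReal) * c) := by
  have hsum := lintegral_add_compl (μ := μ) (fun x => (p x : ℝ≥0∞)) hA
  rw [hp1] at hsum
  have hf : ∫⁻ x in A, (p x : ℝ≥0∞) ∂μ ≠ ⊤ := by
    intro h; simp [h] at hsum
  have hf' : ∫⁻ x in Aᶜ, (p x : ℝ≥0∞) ∂μ ≠ ⊤ := by
    intro h; simp [h] at hsum
  have hr : 1 - (∫⁻ x in A, (p x : ℝ≥0∞) ∂μ).toReal
      = (∫⁻ x in Aᶜ, (p x : ℝ≥0∞) ∂μ).toReal := by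
    have := congrArg ENNReal.toReal hsum
    rw [ENNReal.toReal_add hf hf', ENNReal.toReal_one] at this
    linarith
  rw [hr, ENNReal.ofReal_add (by positivity) (by positivity),
    ENNReal.ofReal_mul ENNReal.toReal_nonneg, ENNReal.ofReal_mul ENNReal.toReal_nonneg,
    ENNReal.ofReal_toReal hf, ENNReal.ofReal_toReal hf', ← lintegral_add_compl _ hA]
  congr 1
  · rw [← lintegral_mul_const' _ _ ENNReal.ofReal_ne_top]
    exact setLIntegral_congr_fun hA fun x hx => by simp [hx]
  · rw [← lintegral_mul_const' _ _ ENNReal.ofReal_ne_top]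
    exact setLIntegral_congr_fun hA.compl fun x hx => by simp_all

lemma exists_discLoss_lt {μ : Measure X} {p q : X → ℝ≥0} (hp : Measurable p)
    (hq : Measurable q) (hp1 : ∫⁻ x, (p x : ℝ≥0∞) ∂μ = 1) (hq1 : ∫⁻ x, (q x : ℝ≥0∞) ∂μ = 1)
    (h : ¬ q =ᵐ[μ] p) :
    ∃ D : Disc X, discLoss μ p q D.1 < ENNReal.ofReal (Real.log 4) := by
  classical
  set A : Set X := {x | q x < p x} with hAdef
  have hA : MeasurableSet A := measurableSet_lt hq hp
  have hPle : ∫⁻ x in A, (p x : ℝ≥0∞) ∂μ ≤ 1 := hp1 ▸ setLIntegral_le_lintegral _ _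
  have hlt : ∫⁻ x in A, (q x : ℝ≥0∞) ∂μ < ∫⁻ x in A, (p x : ℝ≥0∞) ∂μ := by
    by_contra hle
    exact h (ae_eq_of_setLIntegral_lt_le hp hq (by simp [hp1]) (hq1.trans hp1.symm)
      (not_lt.1 hle))
  have hPtop : ∫⁻ x in A, (p x : ℝ≥0∞) ∂μ ≠ ⊤ := ne_top_of_le_ne_top ENNReal.one_ne_top hPle
  set P := (∫⁻ x in A, (p x : ℝ≥0∞) ∂μ).toReal with hP
  set Q := (∫⁻ x in A, (q x : ℝ≥0∞) ∂μ).toReal with hQ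
  have hQP : Q < P := (ENNReal.toReal_lt_toReal hlt.ne_top hPtop).2 hlt
  have hQ0 : 0 ≤ Q := ENNReal.toReal_nonneg
  have hP1 : P ≤ 1 := ENNReal.toReal_le_of_le_ofReal zero_le_one (by simpa using hPle)
  have hgain := perturbation_gain_pos hQ0 hP1 hQP
  set t := (P - Q) / 4 with ht
  have ht0 : 0 < t := by linarith
  have ht1 : t < 1 := by linarith
  have h2 : (0 : ℝ) ≤ Real.log 2 := Real.log_nonneg (by norm_num)
  have ha : 0 ≤ -Real.log ((1 + t) / 2) :=
    neg_nonneg.2 (Real.log_nonpos (by linarith) (by linarith))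
  have hb : 0 ≤ -Real.log ((1 - t) / 2) :=
    neg_nonneg.2 (Real.log_nonpos (by linarith) (by linarith))
  refine ⟨⟨fun x => if x ∈ A then (1 + t) / 2 else 1 / 2,
    Measurable.ite hA measurable_const measurable_const, fun x => ?_⟩, ?_⟩
  · dsimp only
    split_ifs <;> constructor <;> linarith
  have e1 : ∀ x, negLog (if x ∈ A then (1 + t) / 2 else 1 / 2)
      = if x ∈ A then ENNReal.ofReal (-Real.log ((1 + t) / 2))
        else ENNReal.ofReal (Real.log 2) := fun x => by
    split_ifs
    · exact negLog_of_pos (by linarith)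
    · exact negLog_half
  have e2 : ∀ x, negLog (1 - if x ∈ A then (1 + t) / 2 else 1 / 2)
      = if x ∈ A then ENNReal.ofReal (-Real.log ((1 - t) / 2))
        else ENNReal.ofReal (Real.log 2) := fun x => by
    split_ifs
    · rw [show 1 - (1 + t) / 2 = (1 - t) / 2 by ring, negLog_of_pos (by linarith)]
    · rw [show (1 : ℝ) - 1 / 2 = 1 / 2 by norm_num, negLog_half]
  simp only [discLoss, e1, e2]
  rw [lintegral_mul_ite p hA hp1 ha h2, lintegral_mul_ite q hA hq1 hb h2, ← hP, ← hQ,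
    ← ENNReal.ofReal_add (add_nonneg (mul_nonneg (by linarith) ha)
        (mul_nonneg (by linarith) h2))
      (add_nonneg (mul_nonneg hQ0 hb) (mul_nonneg (by linarith) h2)),
    ENNReal.ofReal_lt_ofReal_iff (Real.log_pos (by norm_num)),
    Real.log_div (by linarith) (by norm_num), Real.log_div (by linarith) (by norm_num),
    log_four_eq]
  linarith

lemma neg_log_four_le_iSup_V {μ : Measure X} {p q : X → ℝ≥0}
    (hp1 : ∫⁻ x, (p x : ℝ≥0∞) ∂μ = 1) (hq1 : ∫⁻ x, (q x : ℝ≥0∞) ∂μ = 1) :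
    ((-Real.log 4 : ℝ) : EReal) ≤ ⨆ D : Disc X, V μ p q D.1 := by
  have hD : ∀ _ : X, (1 / 2 : ℝ) ∈ Set.Icc (0 : ℝ) 1 := fun _ => by norm_num
  rw [← (V_eq_iff μ p q hD log_four_nonneg).2 (discLoss_half μ hp1 hq1)]
  exact le_iSup (fun D : Disc X => V μ p q D.1) ⟨fun _ => 1 / 2, measurable_const, hD⟩

lemma iSup_V_eq_neg_log_four_iff {μ : Measure X} {p q : X → ℝ≥0} (hp : Measurable p)
    (hq : Measurable q) (hp1 : ∫⁻ x, (p x : ℝ≥0∞) ∂μ = 1)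
    (hq1 : ∫⁻ x, (q x : ℝ≥0∞) ∂μ = 1) :
    (⨆ D : Disc X, V μ p q D.1) = ((-Real.log 4 : ℝ) : EReal) ↔ q =ᵐ[μ] p := by
  constructor
  · intro hs
    by_contra hne
    obtain ⟨D, hD⟩ := exists_discLoss_lt hp hq hp1 hq1 hne
    exact hD.not_ge ((V_le_iff μ p q D.2.2 log_four_nonneg).1
      (hs ▸ le_iSup (fun D : Disc X => V μ p q D.1) D))
  · intro hqp
    refine le_antisymm (iSup_le fun D => (V_le_iff μ p q D.2.2 log_four_nonneg).2 ?_)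
      (neg_log_four_le_iSup_V hp1 hq1)
    rw [discLoss_congr_right p hqp]
    exact log_four_le_discLoss_self μ hp hp1 D.2.1

end

/-- **Characterization of the saddle point of the GAN minimax game.**
(i) `min_q max_D V(q,D) = -log 4`; (ii) the minimum is attained exactly when `q = p`
`μ`-a.e.; (iii) when `q = p`, any optimal discriminator equals `1/2` `μ`-a.e. on
`{p > 0}`, and the corresponding value is `-log 4`. -/
theorem gan_saddle_point {X : Type*} [MeasurableSpace X] (μ : Measure X)
    (p : X → ℝ≥0) (hp : Measurable p) (hp1 : ∫⁻ x, (p x : ℝ≥0∞) ∂μ = 1) :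
    (⨅ q : Dens X μ, ⨆ D : Disc X, V μ p q.1 D.1) = ((-Real.log 4 : ℝ) : EReal)
      ∧ (∀ q : Dens X μ,
          (⨆ D : Disc X, V μ p q.1 D.1) = ((-Real.log 4 : ℝ) : EReal) ↔ q.1 =ᵐ[μ] p)
      ∧ (∀ Dstar : Disc X, V μ p p Dstar.1 = (⨆ D : Disc X, V μ p p D.1) →
          (∀ᵐ x ∂μ, p x ≠ 0 → Dstar.1 x = 1 / 2)
            ∧ V μ p p Dstar.1 = ((-Real.log 4 : ℝ) : EReal)) := by
  have hpp := (iSup_V_eq_neg_log_four_iff hp hp hp1 hp1).2 (Filter.EventuallyEq.refl _ p)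
  refine ⟨le_antisymm ?_ (le_iInf fun q => neg_log_four_le_iSup_V hp1 q.2.2),
    fun q => iSup_V_eq_neg_log_four_iff hp q.2.1 hp1 q.2.2, fun D hD => ?_⟩
  · rw [← hpp]
    exact iInf_le (fun q : Dens X μ => ⨆ D : Disc X, V μ p q.1 D.1) ⟨p, hp, hp1⟩
  · rw [hpp] at hD
    exact ⟨ae_eq_half_of_discLoss_self_eq μ hp hp1 D.2.1
      ((V_eq_iff μ p p D.2.2 log_four_nonneg).1 hD), hD⟩
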